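/- arXiv:1903.10037 — 2 statements merged into one kernel-verified Lean document; each statement's English description precedes it below -/
import Mathlib

section
/- There exists a unique probability measure ν_V^W on ℝ^V (with the product σ-algebra) such that for every nonempty finite subset U ⊆ V, the pushforward of ν_V^W under the restriction map β ↦ (β_i)_{i∈U} equals ν_U^{W_{U,U}, η_U}, where η_U(i) = Σ_{j∉U} W_{ij}. Moreover, for every λ : V → [0,∞) with finite support, ∫ exp(−⟨λ,β⟩) ν_V^W(dβ) = exp( −(1/2)·Σ_{i≠j} W_{ij}(√((1+λ_i)(1+λ_j)) − 1) ) · ∏_{i∈V} (1+λ_i)^{−1/2} (all but finitely many factors in the sum and product equal 0 and 1 respectively). -/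
open MeasureTheory Matrix

noncomputable section

/-- The Schrödinger operator `H_β = 2·diag(β) − W`. -/
def Hmat {V : Type*} [Fintype V] [DecidableEq V] (W : Matrix V V ℝ) (β : V → ℝ) :
    Matrix V V ℝ :=
  2 • Matrix.diagonal β - W

/-- Density of the measure `ν_V^{W,η}` with respect to Lebesgue measure. -/
def nuDens {V : Type*} [Fintype V] [DecidableEq V] (W : Matrix V V ℝ) (η : V → ℝ)
    (β : V → ℝ) : ENNReal :=
  Set.indicator {β : V → ℝ | (Hmat W β).PosDef}
    (fun β => ENNReal.ofReal
      ((2 / Real.pi) ^ ((Fintype.card V : ℝ) / 2) *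
        Real.exp (-(1 / 2) * ((1 : V → ℝ) ⬝ᵥ (Hmat W β).mulVec 1
            + η ⬝ᵥ (Hmat W β)⁻¹.mulVec η) + η ⬝ᵥ (1 : V → ℝ)) /
        Real.sqrt (Hmat W β).det)) β

/-- The measure `ν_V^{W,η}`. -/
def nuMeas {V : Type*} [Fintype V] [DecidableEq V] (W : Matrix V V ℝ) (η : V → ℝ) :
    Measure (V → ℝ) :=
  volume.withDensity (nuDens W η)

/-- The graph on `V` with an edge `{i,j}` whenever `W i j > 0`. -/
def graphOf {V : Type*} (W : Matrix V V ℝ) : SimpleGraph V :=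
  SimpleGraph.fromRel (fun i j => 0 < W i j)


/-- The compatibility property: for every nonempty finite `U ⊆ V`, the pushforward of `ν`
under the restriction map is `ν_U^{W_{U,U}, η_U}` with `η_U i = Σ_{j∉U} W i j`. -/
def RestrictionProp {V : Type*} [DecidableEq V] (W : V → V → ℝ)
    (ν : Measure (V → ℝ)) : Prop :=
  ∀ U : Finset V, U.Nonempty →
    Measure.map (fun (β : V → ℝ) (i : ↥U) => β i.1) ν
      = nuMeas (Matrix.of fun i j : ↥U => W i.1 j.1)
          (fun i : ↥U => ∑' j : V, if j ∈ U then 0 else W i.1 j)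


lemma aux_deriv (c : ℝ) (hc : 0 < c) (u : ℝ) :
    HasDerivAt (fun u : ℝ => ((u + √(u^2 + 4*c))/2)^2)
      (((u + √(u^2 + 4*c))/2) * (1 + u / √(u^2+4*c))) u := by
  have hp : 0 < u^2 + 4*c := by positivity
  have h1 : HasDerivAt (fun u : ℝ => u^2 + 4*c) (2*u) u := by
    simpa using (hasDerivAt_pow 2 u).add_const (4*c)
  have h2 := h1.sqrt hp.ne'
  have h3 := (((hasDerivAt_id u).add h2).div_const 2).pow 2
  refine HasDerivAt.congr_deriv (f := fun u : ℝ => ((u + √(u^2 + 4*c))/2)^2) h3 ?_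
  simp
  ring

lemma aux_xpos (c : ℝ) (hc : 0 < c) (u : ℝ) : 0 < (u + √(u^2 + 4*c))/2 := by
  have : |u| < √(u^2 + 4*c) := by
    rw [← Real.sqrt_sq_eq_abs]
    exact Real.sqrt_lt_sqrt (sq_nonneg _) (by linarith)
  have := neg_abs_le u
  linarith

lemma aux_x_eq (c : ℝ) (hc : 0 < c) (u : ℝ) :
    ((u + √(u^2 + 4*c))/2) - c / ((u + √(u^2 + 4*c))/2) = u := by
  have h := aux_xpos c hc u
  have h2 : √(u^2+4*c)^2 = u^2+4*c := Real.sq_sqrt (by positivity)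
  set r := √(u^2+4*c)
  have : u + r ≠ 0 := by intro h0; rw [h0] at h; simp at h
  field_simp
  nlinarith

lemma aux_factor_nonneg (c : ℝ) (hc : 0 < c) (u : ℝ) : 0 ≤ 1 + u / √(u^2+4*c) := by
  have h := aux_xpos c hc u
  have hr : 0 < √(u^2+4*c) := Real.sqrt_pos.2 (by positivity)
  rw [show 1 + u / √(u^2+4*c) = 2 * ((u + √(u^2 + 4*c))/2) / √(u^2+4*c) by field_simp; ring]
  positivity

lemma aux_image (c : ℝ) (hc : 0 < c) :
    (fun u : ℝ => ((u + √(u^2 + 4*c))/2)^2) '' Set.univ = Set.Ioi 0 := by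
  ext s
  simp only [Set.image_univ, Set.mem_range, Set.mem_Ioi]
  constructor
  · rintro ⟨u, rfl⟩
    have := aux_xpos c hc u
    positivity
  · intro hs
    have hq : 0 < √s := Real.sqrt_pos.2 hs
    refine ⟨√s - c/√s, ?_⟩
    have : (√s - c/√s)^2 + 4*c = (√s + c/√s)^2 := by field_simp; ring
    rw [this, Real.sqrt_sq (by positivity)]
    rw [show (√s - c / √s + (√s + c / √s)) / 2 = √s by ring, Real.sq_sqrt hs.le]

lemma aux_inj (c : ℝ) (hc : 0 < c) :
    Set.InjOn (fun u : ℝ => ((u + √(u^2 + 4*c))/2)^2) Set.univ := by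
  intro u _ v _ h
  have h' : ((u + √(u^2 + 4*c))/2) = ((v + √(v^2 + 4*c))/2) :=
    (sq_eq_sq₀ (aux_xpos c hc u).le (aux_xpos c hc v).le).1 h
  rw [← aux_x_eq c hc u, ← aux_x_eq c hc v, h']

lemma aux_gauss : ∫ u : ℝ, Real.exp (-(1/2) * u^2) = √(2*Real.pi) := by
  rw [integral_gaussian]; congr 1; ring

lemma aux_bound (c : ℝ) (hc : 0 < c) (u : ℝ) : |u / √(u^2+4*c)| ≤ 1 := by
  have hr : 0 < √(u^2+4*c) := Real.sqrt_pos.2 (by positivity)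
  rw [abs_div, abs_of_pos hr, div_le_one hr, ← Real.sqrt_sq_eq_abs]
  exact Real.sqrt_le_sqrt (by linarith)

lemma aux_int2 (c : ℝ) (hc : 0 < c) :
    Integrable (fun u : ℝ => u / √(u^2+4*c) * Real.exp (-(1/2) * u^2)) := by
  refine (integrable_exp_neg_mul_sq (b := 1/2) (by norm_num)).bdd_mul (c := 1) ?_ ?_
  · exact (by fun_prop : Measurable (fun u : ℝ => u / √(u^2+4*c))).aestronglyMeasurable
  · exact Filter.Eventually.of_forall fun u => aux_bound c hc u

lemma aux_int3 (c : ℝ) (hc : 0 < c) :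
    ∫ u : ℝ, (1 + u / √(u^2+4*c)) * Real.exp (-(1/2) * u^2) = √(2*Real.pi) := by
  have h0 : ∫ u : ℝ, u / √(u^2+4*c) * Real.exp (-(1/2) * u^2) = 0 := by
    have := integral_neg_eq_self (fun u : ℝ => u / √(u^2+4*c) * Real.exp (-(1/2) * u^2)) volume
    simp only [neg_sq, neg_div, neg_mul, integral_neg] at this
    simp only [neg_mul]
    linarith
  have : (fun u : ℝ => (1 + u / √(u^2+4*c)) * Real.exp (-(1/2) * u^2)) =
    fun u => Real.exp (-(1/2) * u^2) + u / √(u^2+4*c) * Real.exp (-(1/2) * u^2) := by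
    ext u; ring
  rw [this, integral_add (integrable_exp_neg_mul_sq (b := 1/2) (by norm_num)) (aux_int2 c hc), h0,
    aux_gauss, add_zero]

lemma scal_pos (c : ℝ) (hc : 0 < c) :
    ∫⁻ s in Set.Ioi (0:ℝ), ENNReal.ofReal (Real.exp (-(1/2)*(s + c^2/s) + c)/√s)
      = ENNReal.ofReal √(2*Real.pi) := by
  rw [← aux_image c hc, lintegral_image_eq_lintegral_abs_deriv_mul MeasurableSet.univ
    (fun u _ => (aux_deriv c hc u).hasDerivWithinAt) (aux_inj c hc), Measure.restrict_univ,
    ← aux_int3 c hc, ofReal_integral_eq_lintegral_ofReal]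
  · refine lintegral_congr fun u => ?_
    have hx := aux_xpos c hc u
    have hf := aux_factor_nonneg c hc u
    have hxe := aux_x_eq c hc u
    rw [← ENNReal.ofReal_mul (abs_nonneg _)]
    congr 1
    rw [abs_of_nonneg (by positivity), Real.sqrt_sq hx.le]
    have : -(1/2) * (((u + √(u^2 + 4*c))/2)^2 + c^2/((u + √(u^2 + 4*c))/2)^2) + c
        = -(1/2) * u^2 := by
      generalize (u + √(u^2 + 4*c))/2 = x at *
      rw [← hxe]; field_simp; ring
    rw [this]
    generalize (u + √(u^2 + 4*c))/2 = x at *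
    field_simp
  · have : (fun u : ℝ => (1 + u / √(u^2+4*c)) * Real.exp (-(1/2) * u^2)) =
      fun u => Real.exp (-(1/2) * u^2) + u / √(u^2+4*c) * Real.exp (-(1/2) * u^2) := by
      ext u; ring
    rw [this]
    exact (integrable_exp_neg_mul_sq (b := 1/2) (by norm_num)).add (aux_int2 c hc)
  · exact Filter.Eventually.of_forall fun u =>
      mul_nonneg (aux_factor_nonneg c hc u) (Real.exp_pos _).le

lemma scal_zero :
    ∫⁻ s in Set.Ioi (0:ℝ), ENNReal.ofReal (Real.exp (-(1/2)*s)/√s)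
      = ENNReal.ofReal √(2*Real.pi) := by
  have h := Real.integral_rpow_mul_exp_neg_mul_Ioi (a := 1/2) (r := 1/2) (by norm_num) (by norm_num)
  have hv : ∫ s in Set.Ioi (0:ℝ), Real.exp (-(1/2)*s)/√s = √(2*Real.pi) := by
    rw [Real.Gamma_one_half_eq, ← Real.sqrt_eq_rpow, ← Real.sqrt_mul (by norm_num)] at h
    rw [show 2 * Real.pi = 1/(1/2) * Real.pi by ring, ← h]
    refine setIntegral_congr_fun measurableSet_Ioi fun s hs => ?_
    simp only [Set.mem_Ioi] at hs
    rw [show (1/2 - 1 : ℝ) = -(1/2) by norm_num, Real.rpow_neg hs.le, ← Real.sqrt_eq_rpow]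
    rw [neg_mul, div_eq_mul_inv, mul_comm]
  rw [← hv, ofReal_integral_eq_lintegral_ofReal]
  · refine Integrable.of_integral_ne_zero ?_
    rw [hv]; positivity
  · exact Filter.Eventually.of_forall fun u => by positivity

lemma scal (c : ℝ) (hc : 0 ≤ c) :
    ∫⁻ s in Set.Ioi (0:ℝ), ENNReal.ofReal (Real.exp (-(1/2)*(s + c^2/s) + c)/√s)
      = ENNReal.ofReal √(2*Real.pi) := by
  rcases hc.eq_or_lt with rfl | hc
  · simpa using scal_zero
  · exact scal_pos c hc


/-- inverse positivity -/
lemma inv_nonneg_vec {A : Type*} [Fintype A] [DecidableEq A] (K : Matrix A A ℝ) (hK : K.PosDef)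
    (hoff : ∀ i j, i ≠ j → K i j ≤ 0) (x : A → ℝ) (hb : ∀ i, 0 ≤ (K *ᵥ x) i) (i : A) :
    0 ≤ x i := by
  by_contra hneg
  push Not at hneg
  let y : A → ℝ := fun i => max (-x i) 0
  have hy0 : y ≠ 0 := by
    intro h
    have := congrFun h i
    simp [y] at this
    linarith
  have hpos := hK.dotProduct_mulVec_pos hy0
  simp only [star_trivial] at hpos
  have h1 : 0 ≤ y ⬝ᵥ (K *ᵥ x) := Finset.sum_nonneg fun i _ => mul_nonneg (le_max_right _ _) (hb i)
  have h2 : y ⬝ᵥ (K *ᵥ (x + y)) ≤ 0 := by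
    simp only [dotProduct, mulVec, Finset.mul_sum]
    refine Finset.sum_nonpos fun i _ => Finset.sum_nonpos fun j _ => ?_
    have hyi : 0 ≤ y i := le_max_right _ _
    have hxj : 0 ≤ (x + y) j := by
      have := le_max_left (-x j) 0
      simp only [Pi.add_apply, y]; linarith
    by_cases hij : i = j
    · subst hij
      have : y i * (x + y) i = 0 := by
        simp only [Pi.add_apply, y]
        rcases le_total (-x i) 0 with h | h
        · simp [max_eq_right h]
        · simp [max_eq_left h]
      rw [show y i * (K i i * (x + y) i) = K i i * (y i * (x + y) i) by ring, this, mul_zero]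
    · have := hoff i j hij
      have h3 := mul_nonneg hyi hxj
      nlinarith
  rw [mulVec_add, dotProduct_add] at h2
  linarith

section schur
variable {A : Type*} [Fintype A] [DecidableEq A]

/-- bordered matrix -/
def bord (K : Matrix A A ℝ) (w : A → ℝ) (a : ℝ) : Matrix (A ⊕ Unit) (A ⊕ Unit) ℝ :=
  fromBlocks K (Matrix.of fun i _ => -w i) (Matrix.of fun _ i => -w i) (Matrix.of fun _ _ => a)

lemma bord_schur (K : Matrix A A ℝ) (w : A → ℝ) (a : ℝ) :
    (Matrix.of fun _ _ => a : Matrix Unit Unit ℝ) -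
      (Matrix.of fun _ i => -w i : Matrix Unit A ℝ) * K⁻¹ * (Matrix.of fun i _ => -w i : Matrix A Unit ℝ)
      = Matrix.of fun _ _ => a - w ⬝ᵥ K⁻¹ *ᵥ w := by
  ext i j
  simp only [Matrix.sub_apply, of_apply, Matrix.mul_assoc]
  congr 1
  simp only [Matrix.mul_apply, of_apply, dotProduct, mulVec]
  refine Finset.sum_congr rfl fun i _ => ?_
  simp [Finset.mul_sum]

lemma bord_det (K : Matrix A A ℝ) (hK : K.PosDef) (w : A → ℝ) (a : ℝ) :
    (bord K w a).det = K.det * (a - w ⬝ᵥ K⁻¹ *ᵥ w) := by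
  let _ := hK.isUnit.invertible
  rw [bord, det_fromBlocks₁₁, invOf_eq_nonsing_inv, bord_schur, det_unique (n := Unit)]
  rfl

lemma bord_posDef (K : Matrix A A ℝ) (hK : K.PosDef) (w : A → ℝ) (a : ℝ) :
    (bord K w a).PosDef ↔ 0 < a - w ⬝ᵥ K⁻¹ *ᵥ w := by
  let _ := hK.isUnit.invertible
  have hB : (Matrix.of fun _ i => -w i : Matrix Unit A ℝ)
      = (Matrix.of fun i _ => -w i : Matrix A Unit ℝ)ᴴ := by
    ext; simp
  have h1 : (bord K w a).PosSemidef ↔ 0 ≤ a - w ⬝ᵥ K⁻¹ *ᵥ w := by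
    rw [bord, hB, PosDef.fromBlocks₁₁ _ _ hK, ← hB, bord_schur]
    constructor
    · intro h
      exact h.diag_nonneg (i := ())
    · intro h
      have : (Matrix.of fun _ _ => a - w ⬝ᵥ K⁻¹ *ᵥ w : Matrix Unit Unit ℝ)
        = diagonal fun _ => a - w ⬝ᵥ K⁻¹ *ᵥ w := by
        ext i j; simp
      rw [this]
      exact PosSemidef.diagonal fun _ => h
  have hd := bord_det K hK w a
  have hKd := hK.det_pos
  constructor
  · intro h
    have := h.det_pos
    rw [hd] at this
    exact (pos_iff_pos_of_mul_pos this).1 hKd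
  · intro h
    rw [(h1.2 h.le).posDef_iff_det_ne_zero, hd]
    positivity

lemma bord_posDef_left (K : Matrix A A ℝ) (w : A → ℝ) (a : ℝ) (h : (bord K w a).PosDef) :
    K.PosDef := by
  have := h.submatrix (Sum.inl_injective (α := A) (β := Unit))
  exact this

lemma bord_inv (K : Matrix A A ℝ) (hK : K.PosDef) (w : A → ℝ) (a : ℝ)
    (hs : 0 < a - w ⬝ᵥ K⁻¹ *ᵥ w) (η : A ⊕ Unit → ℝ) :
    η ⬝ᵥ (bord K w a)⁻¹ *ᵥ η = (η ∘ Sum.inl) ⬝ᵥ K⁻¹ *ᵥ (η ∘ Sum.inl) +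
      (η (Sum.inr ()) + w ⬝ᵥ K⁻¹ *ᵥ (η ∘ Sum.inl))^2 / (a - w ⬝ᵥ K⁻¹ *ᵥ w) := by
  have hP := (bord_posDef K hK w a).2 hs
  have hu := (isUnit_iff_isUnit_det _).1 hP.isUnit
  have huK := (isUnit_iff_isUnit_det _).1 hK.isUnit
  set s := a - w ⬝ᵥ K⁻¹ *ᵥ w with hsdef
  set ηA := η ∘ Sum.inl with hηA
  set c := η (Sum.inr ()) + w ⬝ᵥ K⁻¹ *ᵥ ηA with hc
  let y : A ⊕ Unit → ℝ := Sum.elim (K⁻¹ *ᵥ ηA + (c/s) • K⁻¹ *ᵥ w) (fun _ => c/s)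
  have hη : η = Sum.elim ηA (fun _ => η (Sum.inr ())) := by
    ext i; rcases i with i | i <;> simp [ηA]
  have hsymK : (K⁻¹)ᵀ = K⁻¹ := by
    have := hK.inv.isHermitian
    simpa [IsHermitian, conjTranspose_eq_transpose_of_trivial] using this
  have hy : bord K w a *ᵥ y = η := by
    conv_rhs => rw [hη]
    rw [bord, fromBlocks_mulVec]
    simp only [y, Sum.elim_comp_inl, Sum.elim_comp_inr]
    congr 1
    · rw [mulVec_add, mulVec_smul, mulVec_mulVec, mulVec_mulVec, mul_nonsing_inv _ huK]
      ext i
      simp [mulVec, dotProduct]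
      ring
    · ext i
      have e : (Matrix.of fun (_ : Unit) i => -w i) *ᵥ (K⁻¹ *ᵥ ηA + (c / s) • K⁻¹ *ᵥ w)
        = fun _ => - (w ⬝ᵥ K⁻¹ *ᵥ ηA + (c/s) * (w ⬝ᵥ K⁻¹ *ᵥ w)) := by
        ext i
        rw [← smul_eq_mul, ← dotProduct_smul, ← dotProduct_add, ← neg_dotProduct]
        rfl
      rw [e]
      have e2 : ((Matrix.of fun (_ : Unit) (_ : Unit) => a) *ᵥ fun _ => c/s) i = a * (c/s) := by
        simp [mulVec, dotProduct]
      rw [Pi.add_apply, e2]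
      have : w ⬝ᵥ K⁻¹ *ᵥ w = a - s := by rw [hsdef]; ring
      rw [this]
      have : w ⬝ᵥ K⁻¹ *ᵥ ηA = c - η (Sum.inr ()) := by rw [hc]; ring
      rw [this]
      field_simp
      ring
  have : (bord K w a)⁻¹ *ᵥ η = y := by
    rw [← hy, mulVec_mulVec, nonsing_inv_mul _ hu, one_mulVec]
  rw [this]
  conv_lhs => rw [hη]
  simp only [y]
  rw [sumElim_dotProduct_sumElim, dotProduct_add, dotProduct_smul]
  have hsw : ηA ⬝ᵥ K⁻¹ *ᵥ w = w ⬝ᵥ K⁻¹ *ᵥ ηA := by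
    rw [dotProduct_mulVec, ← mulVec_transpose, hsymK, dotProduct_comm]
  rw [hsw]
  have : w ⬝ᵥ K⁻¹ *ᵥ ηA = c - η (Sum.inr ()) := by rw [hc]; ring
  rw [this]
  simp [dotProduct]
  field_simp
  ring

end schur

lemma Hmat_apply {A : Type*} [Fintype A] [DecidableEq A] (M : Matrix A A ℝ) (β : A → ℝ) (i j : A) :
    Hmat M β i j = 2 * (if i = j then β i else 0) - M i j := by
  rw [Hmat, two_smul, Matrix.sub_apply, Matrix.add_apply, Matrix.diagonal_apply]
  ring

lemma Hmat_cont {A : Type*} [Fintype A] [DecidableEq A] (M : Matrix A A ℝ) :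
    Continuous (Hmat M) := by
  unfold Hmat
  fun_prop

lemma Hmat_symm {A : Type*} [Fintype A] [DecidableEq A] (M : Matrix A A ℝ)
    (hM : ∀ i j, M i j = M j i) (β : A → ℝ) : (Hmat M β).IsHermitian := by
  ext i j
  by_cases h : i = j
  · subst h; simp
  · simp [Hmat_apply, h, Ne.symm h, hM i j]

lemma measurableSet_posDef {A : Type*} [Fintype A] [DecidableEq A] (M : Matrix A A ℝ)
    (hM : ∀ i j, M i j = M j i) : MeasurableSet {β : A → ℝ | (Hmat M β).PosDef} := by
  have : {β : A → ℝ | (Hmat M β).PosDef} =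
      (⋂ x : A → ℝ, {β | 0 ≤ x ⬝ᵥ (Hmat M β) *ᵥ x}) ∩ {β | (Hmat M β).det ≠ 0} := by
    ext β
    simp only [Set.mem_ofPred_eq, Set.mem_inter_iff, Set.mem_iInter]
    constructor
    · intro h
      exact ⟨fun x => by simpa using h.posSemidef.dotProduct_mulVec_nonneg x, h.det_pos.ne'⟩
    · rintro ⟨h1, h2⟩
      have hp : (Hmat M β).PosSemidef :=
        .of_dotProduct_mulVec_nonneg (Hmat_symm M hM β) (fun x => by simpa using h1 x)
      exact hp.posDef_iff_det_ne_zero.2 h2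
  rw [this]
  have hc := Hmat_cont M
  refine MeasurableSet.inter (IsClosed.measurableSet ?_) (IsOpen.measurableSet ?_)
  · exact isClosed_iInter fun x => isClosed_le continuous_const (by fun_prop)
  · exact isOpen_ne_fun (by fun_prop) continuous_const

lemma measurable_nuDens {A : Type*} [Fintype A] [DecidableEq A] (M : Matrix A A ℝ)
    (hM : ∀ i j, M i j = M j i) (η : A → ℝ) : Measurable (nuDens M η) := by
  have hc := Hmat_cont M
  unfold nuDens
  refine Measurable.indicator ?_ (measurableSet_posDef M hM)
  have h1 : Measurable fun β => (1 : A → ℝ) ⬝ᵥ (Hmat M β).mulVec 1 :=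
    Continuous.measurable (by fun_prop)
  have h2 : Measurable fun β => (Hmat M β).det := Continuous.measurable (by fun_prop)
  have h3 : Measurable fun β => η ⬝ᵥ (Hmat M β)⁻¹.mulVec η := by
    have : (fun β => η ⬝ᵥ (Hmat M β)⁻¹.mulVec η) =
      fun β => ((Hmat M β).det)⁻¹ * (η ⬝ᵥ (Hmat M β).adjugate.mulVec η) := by
      ext β
      rw [Matrix.inv_def, smul_mulVec, dotProduct_smul, Ring.inverse_eq_inv', smul_eq_mul]
    rw [this]
    refine h2.inv.mul (Continuous.measurable ?_)
    have : Continuous fun β => (Hmat M β).adjugate := hc.matrix_adjugate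
    fun_prop
  fun_prop

section step
variable {A : Type*} [Fintype A] [DecidableEq A]

lemma Hmat_bord (M : Matrix (A ⊕ Unit) (A ⊕ Unit) ℝ) (hM : ∀ i j, M i j = M j i) (b : A → ℝ)
    (t : ℝ) : Hmat M (Sum.elim b (fun _ => t)) =
      bord (Hmat M.toBlocks₁₁ b) (fun a => M (Sum.inl a) (Sum.inr ()))
        (2 * t - M (Sum.inr ()) (Sum.inr ())) := by
  ext i j
  rcases i with i | i <;> rcases j with j | j
  · by_cases h : i = j
    · subst h; simp [Hmat_apply, bord, toBlocks₁₁]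
    · simp [Hmat_apply, bord, toBlocks₁₁, h]
  · simp [Hmat_apply, bord]
  · simp [Hmat_apply, bord, hM (Sum.inr i)]
  · simp [Hmat_apply, bord]

lemma bord_one (K : Matrix A A ℝ) (w : A → ℝ) (a : ℝ) :
    (1 : A ⊕ Unit → ℝ) ⬝ᵥ (bord K w a) *ᵥ 1 = (1 : A → ℝ) ⬝ᵥ K *ᵥ 1 - 2 * (w ⬝ᵥ 1) + a := by
  simp [bord, dotProduct, mulVec, Fintype.sum_sum_type, Finset.sum_add_distrib]
  ring

lemma lint_affine (q : ℝ) (g : ℝ → ENNReal) :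
    ∫⁻ t, g (2 * t - q) = ENNReal.ofReal (1/2) * ∫⁻ s, g s := by
  have h := lintegral_image_eq_lintegral_abs_deriv_mul (s := Set.univ) (f := fun t : ℝ => 2*t - q)
    (f' := fun _ => 2) MeasurableSet.univ
    (fun t _ => by
      simpa using (((hasDerivAt_id' t).const_mul 2).sub_const q).hasDerivWithinAt (s := Set.univ))
    (fun x _ y _ h => by simpa using h) g
  have him : (fun t : ℝ => 2*t - q) '' Set.univ = Set.univ := by
    rw [Set.image_univ, Set.range_eq_univ]
    intro s; exact ⟨(s+q)/2, by ring⟩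
  rw [him, Measure.restrict_univ, lintegral_const_mul' _ _ (by simp)] at h
  rw [h, ← mul_assoc, ← ENNReal.ofReal_mul (by norm_num)]
  simp

lemma step_dens (M : Matrix (A ⊕ Unit) (A ⊕ Unit) ℝ) (hM : ∀ i j, M i j = M j i)
    (hnn : ∀ i j, 0 ≤ M i j) (η : A ⊕ Unit → ℝ) (hη : ∀ i, 0 ≤ η i) (b : A → ℝ) :
    ∫⁻ t : ℝ, nuDens M η (Sum.elim b (fun _ => t)) =
      nuDens M.toBlocks₁₁ (fun a => η (Sum.inl a) + M (Sum.inl a) (Sum.inr ())) b := by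
  set K := Hmat M.toBlocks₁₁ b with hKdef
  set w : A → ℝ := fun a => M (Sum.inl a) (Sum.inr ()) with hw
  set d := M (Sum.inr ()) (Sum.inr ())
  by_cases hK : K.PosDef
  swap
  · have h1 : nuDens M.toBlocks₁₁ (fun a => η (Sum.inl a) + M (Sum.inl a) (Sum.inr ())) b = 0 :=
      Set.indicator_of_notMem (s := {β : A → ℝ | (Hmat M.toBlocks₁₁ β).PosDef}) hK _
    rw [h1]
    have : ∀ t : ℝ, nuDens M η (Sum.elim b (fun _ => t)) = 0 := fun t => by
      refine Set.indicator_of_notMem ?_ _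
      intro h
      simp only [Set.mem_ofPred_eq] at h
      rw [Hmat_bord M hM] at h
      exact hK (bord_posDef_left _ _ _ h)
    simp [this]
  set ηA := η ∘ Sum.inl with hηA
  set q := w ⬝ᵥ K⁻¹ *ᵥ w with hq
  set c := η (Sum.inr ()) + w ⬝ᵥ K⁻¹ *ᵥ ηA with hc
  have huK := (isUnit_iff_isUnit_det _).1 hK.isUnit
  have hc0 : 0 ≤ c := by
    refine add_nonneg (hη _) (Finset.sum_nonneg fun i _ => mul_nonneg (hnn _ _) ?_)
    refine inv_nonneg_vec K hK ?_ _ ?_ i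
    · intro i j hij
      simp [K, Hmat_apply, hij, toBlocks₁₁, hnn]
    · intro i
      rw [mulVec_mulVec, mul_nonsing_inv _ huK, one_mulVec]
      exact hη _
  have hsymK : (K⁻¹)ᵀ = K⁻¹ := by
    have := hK.inv.isHermitian
    simpa [IsHermitian, conjTranspose_eq_transpose_of_trivial] using this
  have hsw : ηA ⬝ᵥ K⁻¹ *ᵥ w = w ⬝ᵥ K⁻¹ *ᵥ ηA := by
    rw [dotProduct_mulVec, ← mulVec_transpose, hsymK, dotProduct_comm]
  -- the target constant
  set T : ℝ := (2 / Real.pi) ^ ((Fintype.card A : ℝ) / 2) *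
        Real.exp (-(1 / 2) * ((1 : A → ℝ) ⬝ᵥ K.mulVec 1
            + (ηA + w) ⬝ᵥ K⁻¹.mulVec (ηA + w)) + (ηA + w) ⬝ᵥ (1 : A → ℝ)) /
        Real.sqrt K.det with hT
  have hT0 : 0 ≤ T := by positivity
  have hR : nuDens M.toBlocks₁₁ (fun a => η (Sum.inl a) + M (Sum.inl a) (Sum.inr ())) b
      = ENNReal.ofReal T := Set.indicator_of_mem (s := {β : A → ℝ | (Hmat M.toBlocks₁₁ β).PosDef}) hK _
  rw [hR]
  have hL : ∀ t : ℝ, nuDens M η (Sum.elim b (fun _ => t)) =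
      (fun s => ENNReal.ofReal (T * √(2/Real.pi)) * Set.indicator (Set.Ioi 0) (fun s =>
        ENNReal.ofReal (Real.exp (-(1/2)*(s + c^2/s) + c)/√s)) s) (2 * t - (d + q)) := by
    intro t
    have e0 : 2 * t - (d + q) = (2 * t - d) - q := by ring
    simp only
    rw [e0]
    set s := (2 * t - d) - q with hs
    have hiff := bord_posDef K hK w (2 * t - d)
    by_cases hpos : 0 < s
    · have hH := hiff.2 hpos
      rw [nuDens, Set.indicator_of_mem (by simp only [Set.mem_ofPred_eq]; rw [Hmat_bord M hM]; exact hH),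
        Set.indicator_of_mem (by exact hpos), ← ENNReal.ofReal_mul (by positivity)]
      congr 1
      rw [Hmat_bord M hM, ← hKdef, ← hw, bord_one, bord_inv K hK w _ hpos, bord_det K hK,
        ← hηA, ← hq, ← hc, ← hs, Real.sqrt_mul hK.det_pos.le, hT]
      have hcard : (2 / Real.pi) ^ ((Fintype.card (A ⊕ Unit) : ℝ) / 2)
        = (2 / Real.pi) ^ ((Fintype.card A : ℝ) / 2) * √(2/Real.pi) := by
        rw [Real.sqrt_eq_rpow, ← Real.rpow_add (by positivity)]
        congr 1
        simp
        ring
      rw [hcard]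
      have hη1 : η ⬝ᵥ (1 : A ⊕ Unit → ℝ) = ηA ⬝ᵥ (1 : A → ℝ) + η (Sum.inr ()) := by
        simp [dotProduct, ηA, Fintype.sum_sum_type]
      have hexp : -(1 / 2) * ((1 : A → ℝ) ⬝ᵥ K *ᵥ 1 - 2 * w ⬝ᵥ 1 + (2 * t - d)
            + (ηA ⬝ᵥ K⁻¹ *ᵥ ηA + c ^ 2 / s)) + η ⬝ᵥ 1 =
          (-(1 / 2) * ((1 : A → ℝ) ⬝ᵥ K.mulVec 1
            + (ηA + w) ⬝ᵥ K⁻¹.mulVec (ηA + w)) + (ηA + w) ⬝ᵥ (1 : A → ℝ)) +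
          (-(1/2)*(s + c^2/s) + c) := by
        rw [hη1, mulVec_add, dotProduct_add, add_dotProduct, add_dotProduct, add_dotProduct, hsw]
        have : w ⬝ᵥ K⁻¹ *ᵥ ηA = c - η (Sum.inr ()) := by rw [hc]; ring
        rw [this, ← hq]
        have : 2 * t - d = s + q := by rw [hs]; ring
        rw [this]
        ring
      rw [hexp, Real.exp_add]
      ring
    · have hH : ¬ _ := fun h => hpos (hiff.1 h)
      rw [nuDens, Set.indicator_of_notMem (by simp only [Set.mem_ofPred_eq]; rw [Hmat_bord M hM]; exact hH),
        Set.indicator_of_notMem (by exact hpos), mul_zero]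
  rw [lintegral_congr hL, lint_affine (d + q) (fun s => ENNReal.ofReal (T * √(2/Real.pi)) *
      Set.indicator (Set.Ioi 0) (fun s =>
        ENNReal.ofReal (Real.exp (-(1/2)*(s + c^2/s) + c)/√s)) s), lintegral_const_mul' _ _ (by simp),
    lintegral_indicator measurableSet_Ioi, scal c hc0, ← ENNReal.ofReal_mul (by positivity),
    ← ENNReal.ofReal_mul (by positivity)]
  congr 1
  have : √(2 / Real.pi) * √(2 * Real.pi) = 2 := by
    rw [← Real.sqrt_mul (by positivity), show 2 / Real.pi * (2 * Real.pi) = 2^2 by field_simp,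
      Real.sqrt_sq (by norm_num)]
  rw [mul_assoc, this]; ring

lemma step_meas (M : Matrix (A ⊕ Unit) (A ⊕ Unit) ℝ) (hM : ∀ i j, M i j = M j i)
    (hnn : ∀ i j, 0 ≤ M i j) (η : A ⊕ Unit → ℝ) (hη : ∀ i, 0 ≤ η i) :
    Measure.map (fun (β : A ⊕ Unit → ℝ) (a : A) => β (Sum.inl a)) (nuMeas M η) =
      nuMeas M.toBlocks₁₁ (fun a => η (Sum.inl a) + M (Sum.inl a) (Sum.inr ())) := by
  have hmeas := measurable_nuDens M hM η
  have hf : Measurable (fun (β : A ⊕ Unit → ℝ) (a : A) => β (Sum.inl a)) := by fun_prop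
  ext S hS
  rw [Measure.map_apply hf hS, nuMeas, nuMeas, withDensity_apply _ (hf hS),
    withDensity_apply _ hS, ← lintegral_indicator (hf hS), ← lintegral_indicator hS]
  have hp := (volume_measurePreserving_sumPiEquivProdPi_symm (fun _ : A ⊕ Unit => ℝ))
  rw [← hp.lintegral_comp_emb (MeasurableEquiv.measurableEmbedding _), Measure.volume_eq_prod,
    lintegral_prod _ (by
      refine Measurable.aemeasurable ?_
      exact (hmeas.indicator (hf hS)).comp (MeasurableEquiv.measurable _))]
  refine lintegral_congr fun b => ?_
  have hu := (volume_preserving_funUnique Unit ℝ).symm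
  rw [← hu.lintegral_comp_emb (MeasurableEquiv.measurableEmbedding _)]
  by_cases hb : b ∈ S
  · rw [Set.indicator_of_mem hb, ← step_dens M hM hnn η hη b]
    refine lintegral_congr fun t => ?_
    rw [Set.indicator_of_mem (by exact hb)]
    congr 1
  · rw [Set.indicator_of_notMem hb]
    rw [← lintegral_zero (μ := (volume : Measure ℝ))]
    refine lintegral_congr fun t => ?_
    rw [Set.indicator_of_notMem (by exact hb)]

end step

lemma reindex_meas {A B : Type*} [Fintype A] [DecidableEq A] [Fintype B] [DecidableEq B]
    (e : A ≃ B) (M : Matrix B B ℝ) (hM : ∀ i j, M i j = M j i) (η : B → ℝ) :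
    Measure.map (fun (β : B → ℝ) (a : A) => β (e a)) (nuMeas M η) =
      nuMeas (M.submatrix e e) (η ∘ e) := by
  have hH : ∀ β : B → ℝ, Hmat (M.submatrix e e) (fun a => β (e a)) = (Hmat M β).submatrix e e := by
    intro β
    ext i j
    simp [Hmat_apply]
  have hd : ∀ β : B → ℝ, nuDens (M.submatrix e e) (η ∘ e) (fun a => β (e a)) = nuDens M η β := by
    intro β
    have hdot : ∀ x y : B → ℝ, (x ∘ e) ⬝ᵥ (y ∘ e) = x ⬝ᵥ y := fun x y =>
      comp_equiv_dotProduct_comp_equiv x y e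
    have h1 : ∀ N : Matrix B B ℝ, ∀ x : B → ℝ, N.submatrix e e *ᵥ (x ∘ e) = (N *ᵥ x) ∘ e := by
      intro N x
      rw [submatrix_mulVec_equiv]
      congr 2
      ext; simp
    have h11 : (1 : A → ℝ) = (1 : B → ℝ) ∘ e := rfl
    have hP : (Hmat (M.submatrix e e) (fun a => β (e a))).PosDef ↔ (Hmat M β).PosDef := by
      rw [hH]
      constructor
      · intro h
        have := h.submatrix e.symm.injective
        simpa using this
      · intro h
        exact h.submatrix e.injective
    unfold nuDens
    by_cases h : (Hmat M β).PosDef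
    · rw [Set.indicator_of_mem (by exact hP.2 h), Set.indicator_of_mem (by exact h), hH,
        inv_submatrix_equiv, h11, h1, h1, hdot, hdot, hdot, det_submatrix_equiv_self,
        Fintype.card_congr e]
    · rw [Set.indicator_of_notMem (by exact fun h' => h (hP.1 h')),
        Set.indicator_of_notMem (by exact h)]
  have hp := (volume_measurePreserving_piCongrLeft (fun _ : A => ℝ) e.symm)
  have hfun : (fun (β : B → ℝ) (a : A) => β (e a)) =
      MeasurableEquiv.piCongrLeft (fun _ : A => ℝ) e.symm := by
    ext β a
    have := Equiv.piCongrLeft_apply_apply (fun _ : A => ℝ) e.symm β (e a)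
    simp at this
    exact this.symm
  ext S hS
  rw [hfun, Measure.map_apply (MeasurableEquiv.measurable _) hS, nuMeas, nuMeas,
    withDensity_apply _ (MeasurableEquiv.measurable _ hS),
    withDensity_apply _ hS, ← hp.setLIntegral_comp_preimage_emb (MeasurableEquiv.measurableEmbedding _)]
  refine lintegral_congr fun β => ?_
  rw [← hfun]
  exact (hd β).symm

section kolm
open ProbabilityTheory Finset Preorder

lemma kolm_nat (P : ∀ J : Finset ℕ, Measure (J → ℝ)) [∀ J, IsProbabilityMeasure (P J)]
    (hP : IsProjectiveMeasureFamily (α := fun _ => ℝ) P) : ∃ ν : Measure (ℕ → ℝ), IsProjectiveLimit (α := fun _ => ℝ) ν P := by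
  let κ : (n : ℕ) → Kernel (Iic n → ℝ) ℝ := fun n =>
    condDistrib (fun β : Iic (n+1) → ℝ => β ⟨n+1, by simp⟩)
      (frestrictLe₂ (π := fun _ => ℝ) (Nat.le_succ n)) (P (Iic (n+1)))
  have hκ : ∀ n, IsMarkovKernel (κ n) := fun n => by
    simp only [κ]; infer_instance
  let μ₀ : Measure ℝ := (P (Iic 0)).map (fun β => β ⟨0, by simp⟩)
  have hμ₀ : IsProbabilityMeasure μ₀ := Measure.isProbabilityMeasure_map (measurable_pi_apply _).aemeasurable
  let ν : Measure (ℕ → ℝ) := Kernel.trajMeasure (X := fun _ => ℝ) μ₀ κ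
  refine ⟨ν, (isProjectiveLimit_nat_iff (X := fun _ => ℝ) hP ν).2 fun n => ?_⟩
  induction n with
  | zero =>
    simp only [ν, Kernel.trajMeasure]
    rw [Measure.map_comp _ _ (by fun_prop), Kernel.traj_map_frestrictLe, Kernel.partialTraj_self,
      Measure.id_comp, Measure.map_map (by fun_prop) (by fun_prop)]
    convert Measure.map_id using 2
    ext β i
    have hi : (i : ℕ) = 0 := Nat.le_zero.1 (Finset.mem_Iic.1 i.2)
    have hi' : i = ⟨0, by simp⟩ := Subtype.ext hi
    subst hi'
    rfl
  | succ n ih =>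
    let g : (Iic n → ℝ) × ℝ → (Iic (n+1) → ℝ) := fun p i =>
      if h : (i : ℕ) ≤ n then p.1 ⟨i, by simpa using h⟩ else p.2
    have hg : Measurable g := by
      refine measurable_pi_lambda _ fun i => ?_
      by_cases h : (i : ℕ) ≤ n
      · simp only [g, h, dite_true]; fun_prop
      · simp only [g, h, dite_false]; fun_prop
    have h1 := Kernel.map_frestrictLe_trajMeasure_compProd_eq_map_trajMeasure
      (X := fun _ => ℝ) (μ₀ := μ₀) (κ := κ) (a := n)
    have h2 := compProd_map_condDistrib (mβ := MeasurableSpace.pi) (μ := P (Iic (n+1)))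
      (X := frestrictLe₂ (π := fun _ => ℝ) (Nat.le_succ n))
      (Y := fun β : Iic (n+1) → ℝ => β ⟨n+1, by simp⟩) (measurable_pi_apply _).aemeasurable
    have h3 : (P (Iic (n+1))).map (frestrictLe₂ (π := fun _ => ℝ) (Nat.le_succ n)) = P (Iic n) :=
      (hP (Iic (n+1)) (Iic n) (Iic_subset_Iic.2 (Nat.le_succ n))).symm
    rw [h3] at h2
    change ν.map (frestrictLe n) ⊗ₘ κ n = ν.map _ at h1
    rw [ih] at h1
    have h4 := h1.symm.trans h2
    have h5 := congrArg (Measure.map g) h4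
    rw [Measure.map_map hg (by fun_prop), Measure.map_map hg
      ((measurable_frestrictLe₂ (X := fun _ => ℝ) (Nat.le_succ n)).prodMk (measurable_pi_apply _))] at h5
    have e1 : g ∘ (fun x : ℕ → ℝ => (frestrictLe (π := fun _ => ℝ) n x, x (n+1)))
        = frestrictLe (π := fun _ => ℝ) (n+1) := by
      ext x i
      by_cases h : (i : ℕ) ≤ n
      · simp [g, h]
      · have hi : (i : ℕ) = n+1 := by
          have := i.2
          simp only [Finset.mem_Iic] at this
          omega
        simp [g, h, hi]
    have e2 : g ∘ (fun a : Iic (n+1) → ℝ => (frestrictLe₂ (π := fun _ => ℝ) (Nat.le_succ n) a,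
        a ⟨n+1, by simp⟩)) = id := by
      ext x i
      by_cases h : (i : ℕ) ≤ n
      · simp [g, h]
      · have hi : (i : ℕ) = n+1 := by
          have := i.2
          simp only [Finset.mem_Iic] at this
          omega
        have hi' : i = ⟨n+1, by simp⟩ := Subtype.ext hi
        subst hi'
        simp [g]
    rw [e1, e2, Measure.map_id] at h5
    exact h5

lemma kolm {V : Type*} [Countable V] [Infinite V]
    (P : ∀ J : Finset V, Measure (J → ℝ)) [∀ J, IsProbabilityMeasure (P J)]
    (hP : IsProjectiveMeasureFamily (α := fun _ => ℝ) P) : ∃ ν : Measure (V → ℝ), IsProjectiveLimit (α := fun _ => ℝ) ν P := by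
  obtain ⟨e⟩ : Nonempty (V ≃ ℕ) := nonempty_equiv_of_countable
  let f : ∀ J : Finset ℕ, (↥(J.map e.symm.toEmbedding) → ℝ) → (J → ℝ) :=
    fun J β j => β ⟨e.symm j, by simp⟩
  have hf : ∀ J, Measurable (f J) := fun J => by simp only [f]; fun_prop
  let P' : ∀ J : Finset ℕ, Measure (J → ℝ) := fun J => (P (J.map e.symm.toEmbedding)).map (f J)
  have hprob : ∀ J, IsProbabilityMeasure (P' J) := fun J =>
    Measure.isProbabilityMeasure_map (hf J).aemeasurable
  have hP' : IsProjectiveMeasureFamily (α := fun _ => ℝ) P' := by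
    intro I J hJI
    simp only [P']
    rw [hP (I.map e.symm.toEmbedding) (J.map e.symm.toEmbedding) (Finset.map_subset_map.2 hJI),
      Measure.map_map (hf J) (Finset.measurable_restrict₂ _),
      Measure.map_map (Finset.measurable_restrict₂ (X := fun _ : ℕ => ℝ) hJI) (hf I)]
    rfl
  obtain ⟨ν', hν'⟩ := kolm_nat P' hP'
  refine ⟨ν'.map (fun f v => f (e v)), fun U => ?_⟩
  let g : (↥(U.map e.toEmbedding) → ℝ) → (U → ℝ) := fun β u => β ⟨e u, by simp⟩
  have hg : Measurable g := by simp only [g]; fun_prop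
  have h1 := congrArg (Measure.map g) (hν' (U.map e.toEmbedding))
  simp only [P'] at h1
  rw [Measure.map_map hg (by fun_prop), Measure.map_map hg (hf _)] at h1
  rw [Measure.map_map (by fun_prop) (by fun_prop)]
  refine Eq.trans h1 ?_
  have hsub : U ⊆ (U.map e.toEmbedding).map e.symm.toEmbedding := by
    intro u hu; simp [hu]
  rw [hP _ U hsub]
  congr 1
  ext β u
  simp [g, f, restrict₂]

end kolm

section fam
variable {V : Type*} [DecidableEq V]

/-- the boundary field -/
def etaOf (W : V → V → ℝ) (U : Finset V) : ↥U → ℝ :=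
  fun i : ↥U => ∑' j : V, if j ∈ U then 0 else W i.1 j

/-- the finite-dimensional family -/
def famP (W : V → V → ℝ) (U : Finset V) : Measure (↥U → ℝ) :=
  nuMeas (Matrix.of fun i j : ↥U => W i.1 j.1) (etaOf W U)

lemma summ_aux (W : V → V → ℝ) (hnn : ∀ i j, 0 ≤ W i j)
    (hloc : ∀ i, {j | 0 < W i j}.Finite) (U : Finset V) (i : V) :
    Summable fun j => if j ∈ U then 0 else W i j := by
  refine summable_of_hasFiniteSupport ((hloc i).subset fun j hj => ?_)
  simp only [Function.mem_support] at hj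
  have : W i j ≠ 0 := by
    intro h; apply hj; simp [h]
  exact lt_of_le_of_ne (hnn i j) this.symm

lemma eta_insert (W : V → V → ℝ) (hnn : ∀ i j, 0 ≤ W i j)
    (hloc : ∀ i, {j | 0 < W i j}.Finite) (J : Finset V) (n : V) (hn : n ∉ J) (i : V) :
    (∑' j : V, if j ∈ insert n J then 0 else W i j) + W i n = ∑' j : V, if j ∈ J then 0 else W i j := by
  rw [(summ_aux W hnn hloc J i).tsum_eq_add_tsum_ite n, if_neg hn, add_comm]
  congr 2
  ext j
  by_cases h : j = n <;> simp [h]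

/-- index equivalence -/
def insEquiv (J : Finset V) (n : V) (hn : n ∉ J) : ↥J ⊕ Unit ≃ ↥(insert n J) :=
  (Equiv.optionEquivSumPUnit.{0} ↥J).symm.trans (Finset.subtypeInsertEquivOption hn).symm

lemma proj_insert (W : V → V → ℝ) (hsymm : ∀ i j, W i j = W j i) (hnn : ∀ i j, 0 ≤ W i j)
    (hloc : ∀ i, {j | 0 < W i j}.Finite) (J : Finset V) (n : V) (hn : n ∉ J) :
    Measure.map (Finset.restrict₂ (π := fun _ => ℝ) (Finset.subset_insert n J))
      (famP W (insert n J)) = famP W J := by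
  let e := insEquiv J n hn
  have h1 := reindex_meas e (Matrix.of fun i j : ↥(insert n J) => W i.1 j.1)
    (fun i j => hsymm _ _) (etaOf W (insert n J))
  have h2 := step_meas ((Matrix.of fun i j : ↥(insert n J) => W i.1 j.1).submatrix e e)
    (fun i j => hsymm _ _) (fun i j => hnn _ _) (etaOf W (insert n J) ∘ e)
    (fun i => tsum_nonneg fun j => by split_ifs <;> simp [hnn])
  rw [← h1, Measure.map_map (by fun_prop) (by fun_prop)] at h2
  refine Eq.trans h2 ?_
  unfold famP
  congr 1
  ext i
  exact eta_insert W hnn hloc J n hn i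

lemma famP_proj (W : V → V → ℝ) (hsymm : ∀ i j, W i j = W j i) (hnn : ∀ i j, 0 ≤ W i j)
    (hloc : ∀ i, {j | 0 < W i j}.Finite) :
    IsProjectiveMeasureFamily (α := fun _ => ℝ) (famP W) := by
  have key : ∀ (S J I : Finset V) (hJI : J ⊆ I), I = S ∪ J → famP W J =
      (famP W I).map (Finset.restrict₂ (π := fun _ => ℝ) hJI) := by
    intro S
    induction S using Finset.induction_on with
    | empty =>
      intro J I hJI h
      rw [Finset.empty_union] at h
      subst h
      exact Measure.map_id.symm
    | insert a S ha ih =>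
      intro J I hJI h
      by_cases haJ : a ∈ S ∪ J
      · exact ih J I hJI (by rw [h, Finset.insert_union, Finset.insert_eq_of_mem haJ])
      · rw [Finset.insert_union] at h
        subst h
        rw [ih J (S ∪ J) Finset.subset_union_right rfl, ← proj_insert W hsymm hnn hloc _ a haJ,
          Measure.map_map (Finset.measurable_restrict₂ (X := fun _ => ℝ) _)
            (Finset.measurable_restrict₂ (X := fun _ => ℝ) _)]
        rfl
  intro I J hJI
  exact key I J I hJI (by rw [Finset.union_eq_left.2 hJI])

lemma famP_empty (W : V → V → ℝ) : famP W ∅ Set.univ = 1 := by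
  unfold famP nuMeas
  rw [withDensity_apply _ MeasurableSet.univ, Measure.restrict_univ, volume_pi, Measure.pi_of_empty,
    lintegral_dirac, nuDens, Set.indicator_of_mem]
  · simp
  · have : ∀ N : Matrix ↥(∅ : Finset V) ↥(∅ : Finset V) ℝ, N.PosDef := by
      intro N
      rw [Subsingleton.elim N 1]
      exact PosDef.one
    exact this _

lemma famP_prob (W : V → V → ℝ) (hsymm : ∀ i j, W i j = W j i) (hnn : ∀ i j, 0 ≤ W i j)
    (hloc : ∀ i, {j | 0 < W i j}.Finite) (U : Finset V) : IsProbabilityMeasure (famP W U) := by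
  constructor
  rw [(famP_proj W hsymm hnn hloc).measure_univ_eq U ∅]
  exact famP_empty W

lemma restr_iff (W : V → V → ℝ) (hsymm : ∀ i j, W i j = W j i) (hnn : ∀ i j, 0 ≤ W i j)
    (hloc : ∀ i, {j | 0 < W i j}.Finite) [Nonempty V] (ν : Measure (V → ℝ)) :
    RestrictionProp W ν ↔ IsProjectiveLimit (α := fun _ => ℝ) ν (famP W) := by
  constructor
  · intro h U
    by_cases hU : U.Nonempty
    · exact h U hU
    · rw [Finset.not_nonempty_iff_eq_empty] at hU
      subst hU
      obtain ⟨v⟩ := ‹Nonempty V›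
      have h1 : Measure.map (Finset.restrict (π := fun _ => ℝ) {v}) ν = famP W {v} :=
        h {v} (Finset.singleton_nonempty v)
      rw [famP_proj W hsymm hnn hloc {v} ∅ (Finset.empty_subset _), ← h1,
        Measure.map_map (Finset.measurable_restrict₂ (X := fun _ => ℝ) _)
          (Finset.measurable_restrict (X := fun _ => ℝ) _)]
      rfl
  · intro h U _
    exact h U

end fam

section laplace
variable {A : Type*} [Fintype A] [DecidableEq A]

lemma Hmat_scale (M : Matrix A A ℝ) (r : A → ℝ) (β : A → ℝ) :
    Hmat (Matrix.of fun i j => r i * M i j * r j) (fun i => r i ^ 2 * β i)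
      = diagonal r * Hmat M β * diagonal r := by
  ext i j
  rw [mul_diagonal, diagonal_mul, Hmat_apply, Hmat_apply]
  by_cases h : i = j
  · subst h; simp; ring
  · simp [h]

lemma one_Hmat (M : Matrix A A ℝ) (β : A → ℝ) :
    (1 : A → ℝ) ⬝ᵥ Hmat M β *ᵥ 1 = 2 * ∑ i, β i - ∑ i, ∑ j, M i j := by
  simp [dotProduct, mulVec, Hmat_apply, Finset.sum_sub_distrib, Finset.mul_sum]

/-- pointwise scaling identity -/
lemma dens_scale (M : Matrix A A ℝ) (η : A → ℝ) (r : A → ℝ) (hr : ∀ i, 0 < r i) (β : A → ℝ) :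
    ENNReal.ofReal (Real.exp (-∑ i, (r i ^ 2 - 1) * β i)) * nuDens M η β =
      ENNReal.ofReal ((∏ i, r i) * Real.exp ((1/2) * ((∑ i, ∑ j, M i j)
          - ∑ i, ∑ j, r i * M i j * r j) + (∑ i, η i - ∑ i, r i * η i))) *
        nuDens (Matrix.of fun i j => r i * M i j * r j) (fun i => r i * η i)
          (fun i => r i ^ 2 * β i) := by
  have hH := Hmat_scale M r β
  have hD : IsUnit (diagonal r) := by
    rw [isUnit_iff_isUnit_det, det_diagonal]
    exact (Finset.prod_pos fun i _ => hr i).ne'.isUnit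
  have hstar : star (diagonal r) = diagonal r := by
    rw [star_eq_conjTranspose, diagonal_conjTranspose]; rfl
  have hP : (Hmat (Matrix.of fun i j => r i * M i j * r j) (fun i => r i ^ 2 * β i)).PosDef
      ↔ (Hmat M β).PosDef := by
    rw [hH]
    have := hD.posDef_star_left_conjugate_iff (x := Hmat M β)
    rwa [hstar] at this
  unfold nuDens
  by_cases h : (Hmat M β).PosDef
  swap
  · rw [Set.indicator_of_notMem (by exact h),
      Set.indicator_of_notMem (by exact fun h' => h (hP.1 h'))]
    simp
  rw [Set.indicator_of_mem (by exact h), Set.indicator_of_mem (by exact hP.2 h)]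
  have hprod : 0 < ∏ i, r i := Finset.prod_pos fun i _ => hr i
  have hdet := h.det_pos
  rw [← ENNReal.ofReal_mul (by positivity), ← ENNReal.ofReal_mul (by positivity)]
  congr 1
  have hq : (fun i => r i * η i) ⬝ᵥ
      (Hmat (Matrix.of fun i j => r i * M i j * r j) (fun i => r i ^ 2 * β i))⁻¹ *ᵥ
        (fun i => r i * η i) = η ⬝ᵥ (Hmat M β)⁻¹ *ᵥ η := by
    have e1 : (fun i => r i * η i) = diagonal r *ᵥ η := by
      ext i; rw [mulVec_diagonal]
    have hu := (isUnit_iff_isUnit_det _).1 hD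
    rw [hH, Matrix.mul_inv_rev, Matrix.mul_inv_rev, e1, mulVec_mulVec, Matrix.mul_assoc,
      Matrix.mul_assoc, nonsing_inv_mul _ hu, Matrix.mul_one, ← vecMul_transpose,
      diagonal_transpose, ← dotProduct_mulVec, mulVec_mulVec, ← Matrix.mul_assoc,
      mul_nonsing_inv _ hu, Matrix.one_mul]
  have hd : (Hmat (Matrix.of fun i j => r i * M i j * r j) (fun i => r i ^ 2 * β i)).det
      = (∏ i, r i)^2 * (Hmat M β).det := by
    rw [hH, det_mul, det_mul, det_diagonal]; ring
  rw [hq, hd, Real.sqrt_mul (sq_nonneg _), Real.sqrt_sq hprod.le, one_Hmat, one_Hmat]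
  simp only [of_apply]
  have e3 : (fun i => r i * η i) ⬝ᵥ (1 : A → ℝ) = ∑ i, r i * η i := by simp [dotProduct]
  have e4 : η ⬝ᵥ (1 : A → ℝ) = ∑ i, η i := by simp [dotProduct]
  rw [e3, e4]
  have e5 : ∑ i, (r i ^ 2 - 1) * β i = ∑ i, r i ^ 2 * β i - ∑ i, β i := by
    rw [← Finset.sum_sub_distrib]
    exact Finset.sum_congr rfl fun i _ => by ring
  rw [e5]
  generalize (2 / Real.pi) ^ ((Fintype.card A : ℝ) / 2) = k
  generalize hx1 : -(1 / 2) * (2 * ∑ i, β i - ∑ i, ∑ j, M i j + η ⬝ᵥ (Hmat M β)⁻¹ *ᵥ η) +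
    ∑ i, η i = x1
  generalize hx2 : -(1 / 2) * (2 * ∑ i, r i ^ 2 * β i - ∑ i, ∑ j, r i * M i j * r j +
    η ⬝ᵥ (Hmat M β)⁻¹ *ᵥ η) + ∑ i, r i * η i = x2
  generalize hx3 : -(∑ i, r i ^ 2 * β i - ∑ i, β i) = x3
  generalize hx4 : (1/2) * ((∑ i, ∑ j, M i j)
          - ∑ i, ∑ j, r i * M i j * r j) + (∑ i, η i - ∑ i, r i * η i) = x4
  have hx : x3 + x1 = x4 + x2 := by
    rw [← hx1, ← hx2, ← hx3, ← hx4]; ring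
  have hxe : Real.exp x3 * Real.exp x1 = Real.exp x4 * Real.exp x2 := by
    rw [← Real.exp_add, ← Real.exp_add, hx]
  have hs : 0 < √(Hmat M β).det := Real.sqrt_pos.2 hdet
  field_simp
  linear_combination k * hxe

lemma laplace_fin (M : Matrix A A ℝ) (hM : ∀ i j, M i j = M j i) (η : A → ℝ) (r : A → ℝ)
    (hr : ∀ i, 0 < r i)
    (h1 : nuMeas (Matrix.of fun i j => r i * M i j * r j) (fun i => r i * η i) Set.univ = 1) :
    ∫ β, Real.exp (-∑ i, (r i ^ 2 - 1) * β i) ∂(nuMeas M η) =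
      (∏ i, r i)⁻¹ * Real.exp ((1/2) * ((∑ i, ∑ j, M i j)
          - ∑ i, ∑ j, r i * M i j * r j) + (∑ i, η i - ∑ i, r i * η i)) := by
  have hprod : 0 < ∏ i, r i := Finset.prod_pos fun i _ => hr i
  rw [integral_eq_lintegral_of_nonneg_ae (Filter.Eventually.of_forall fun _ => (Real.exp_pos _).le)
    (Measurable.aestronglyMeasurable (by fun_prop))]
  rw [nuMeas, lintegral_withDensity_eq_lintegral_mul _ (measurable_nuDens M hM η) (by fun_prop)]
  have hM' : ∀ i j, (Matrix.of fun i j => r i * M i j * r j) i j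
      = (Matrix.of fun i j => r i * M i j * r j) j i := fun i j => by
    simp only [of_apply]; rw [hM i j]; ring
  have hm' := measurable_nuDens (Matrix.of fun i j => r i * M i j * r j) hM' (fun i => r i * η i)
  have hdetD : (diagonal fun i => r i ^ 2).det = (∏ i, r i)^2 := by
    rw [det_diagonal, Finset.prod_pow]
  have hvol := Real.smul_map_diagonal_volume_pi (D := fun i => r i ^ 2) (by rw [hdetD]; positivity)
  rw [nuMeas, withDensity_apply _ MeasurableSet.univ, Measure.restrict_univ, ← hvol,
    lintegral_smul_measure, lintegral_map hm' (LinearMap.continuous_of_finiteDimensional _).measurable,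
    hdetD] at h1
  have e : ∀ β : A → ℝ, (toLin' (diagonal fun i => r i ^ 2)) β = fun i => r i ^ 2 * β i := by
    intro β; ext i; simp [mulVec_diagonal]
  simp only [e] at h1
  have e2 : ∀ β : A → ℝ, (nuDens M η * fun β : A → ℝ =>
      ENNReal.ofReal (Real.exp (-∑ i, (r i ^ 2 - 1) * β i))) β
     = ENNReal.ofReal ((∏ i, r i) * Real.exp ((1/2) * ((∑ i, ∑ j, M i j)
          - ∑ i, ∑ j, r i * M i j * r j) + (∑ i, η i - ∑ i, r i * η i))) *
        nuDens (Matrix.of fun i j => r i * M i j * r j) (fun i => r i * η i)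
          (fun i => r i ^ 2 * β i) := fun β => (mul_comm _ _).trans (dens_scale M η r hr β)
  rw [lintegral_congr e2, lintegral_const_mul' _ _ (by simp)]
  set L := ∫⁻ β : A → ℝ, nuDens (Matrix.of fun i j => r i * M i j * r j) (fun i => r i * η i)
          (fun i => r i ^ 2 * β i)
  rw [abs_of_pos (by positivity)] at h1
  have hL : L.toReal = ((∏ i, r i)^2)⁻¹ := by
    have := congrArg ENNReal.toReal h1
    rw [smul_eq_mul, ENNReal.toReal_mul, ENNReal.toReal_ofReal (by positivity)] at this
    simp only [ENNReal.toReal_one] at this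
    exact eq_inv_of_mul_eq_one_right this
  rw [ENNReal.toReal_mul, ENNReal.toReal_ofReal (by positivity), hL]
  field_simp

end laplace

theorem stmt5 {V : Type*} [Countable V] [Infinite V] [DecidableEq V]
    (W : V → V → ℝ) (hsymm : ∀ i j, W i j = W j i) (hnn : ∀ i j, 0 ≤ W i j)
    (hdiag : ∀ i, W i i = 0) (hloc : ∀ i, {j | 0 < W i j}.Finite)
    (hconn : (SimpleGraph.fromRel fun i j => 0 < W i j).Connected) :
    (∃! ν : Measure (V → ℝ), IsProbabilityMeasure ν ∧ RestrictionProp W ν) ∧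
      ∀ ν : Measure (V → ℝ), IsProbabilityMeasure ν → RestrictionProp W ν →
        ∀ l : V → ℝ, (∀ i, 0 ≤ l i) → (Function.support l).Finite →
          ∫ β, Real.exp (-(∑' i, l i * β i)) ∂ν
            = Real.exp (-(1 / 2) * ∑' p : V × V,
                  if p.1 = p.2 then 0
                  else W p.1 p.2 * (Real.sqrt ((1 + l p.1) * (1 + l p.2)) - 1))
              * ∏' i : V, (1 + l i) ^ (-(1 / 2) : ℝ) := by
  haveI hprob : ∀ U, IsProbabilityMeasure (famP W U) := famP_prob W hsymm hnn hloc
  constructor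
  · obtain ⟨ν, hν⟩ := kolm (famP W) (famP_proj W hsymm hnn hloc)
    refine ⟨ν, ⟨hν.isProbabilityMeasure, (restr_iff W hsymm hnn hloc ν).2 hν⟩, ?_⟩
    rintro μ ⟨_, hμ⟩
    exact ((restr_iff W hsymm hnn hloc μ).1 hμ).unique hν
  · intro ν hν hR l hl hfin
    obtain ⟨v0⟩ : Nonempty V := inferInstance
    have hbig : (insert v0 (Function.support l ∪
        ⋃ i ∈ Function.support l, {j | 0 < W i j})).Finite :=
      (hfin.union (hfin.biUnion fun i _ => hloc i)).insert v0
    obtain ⟨U, hUeq⟩ : ∃ U : Finset V, (U : Set V) = insert v0 (Function.support l ∪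
        ⋃ i ∈ Function.support l, {j | 0 < W i j}) := ⟨hbig.toFinset, by simp⟩
    have hUne : U.Nonempty := ⟨v0, by
      rw [← Finset.mem_coe, hUeq]; exact Set.mem_insert _ _⟩
    have hUs : ∀ i, i ∉ U → l i = 0 := by
      intro i hi
      by_contra h
      apply hi
      rw [← Finset.mem_coe, hUeq]
      exact Or.inr (Or.inl h)
    have hUn : ∀ i j, l i ≠ 0 → j ∉ U → W i j = 0 := by
      intro i j hi hj
      by_contra h
      apply hj
      rw [← Finset.mem_coe, hUeq]
      refine Or.inr (Or.inr ?_)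
      exact Set.mem_biUnion (show i ∈ Function.support l from hi)
        (lt_of_le_of_ne (hnn i j) (Ne.symm h))
    clear hUeq
    set r : V → ℝ := fun i => Real.sqrt (1 + l i) with hrdef
    have hrpos : ∀ i, 0 < r i := fun i => Real.sqrt_pos.2 (by linarith [hl i])
    have hrsq : ∀ i, r i ^ 2 - 1 = l i := fun i => by
      rw [hrdef]; simp only []
      rw [Real.sq_sqrt (by linarith [hl i])]; ring
    have hr1 : ∀ i, l i = 0 → r i = 1 := fun i hi => by
      simp [hrdef, hi]
    have hW'nn : ∀ i j, 0 ≤ r i * W i j * r j := fun i j =>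
      mul_nonneg (mul_nonneg (hrpos i).le (hnn i j)) (hrpos j).le
    have hmass := famP_prob (fun i j => r i * W i j * r j)
      (fun i j => by rw [hsymm i j]; ring) hW'nn (fun i => (hloc i).subset (by
        intro j hj
        refine lt_of_le_of_ne (hnn i j) ?_
        intro h
        simp only [Set.mem_setOf_eq] at hj
        rw [← h] at hj
        simp at hj)) U
    have heta : etaOf (fun i j => r i * W i j * r j) U = fun i => r i.1 * etaOf W U i := by
      funext i
      simp only [etaOf]
      rw [← tsum_mul_left]
      congr 1
      funext j
      split_ifs with h
      · simp
      · rw [hr1 j (hUs j h)]; ring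
    have hreta : ∀ i : ↥U, r i.1 * etaOf W U i = etaOf W U i := by
      intro i
      by_cases h : l i.1 = 0
      · rw [hr1 _ h, one_mul]
      · have : etaOf W U i = 0 := by
          simp only [etaOf]
          have hz : (fun j : V => if j ∈ U then 0 else W i.1 j) = fun _ => 0 := by
            funext j
            split_ifs with hj
            · rfl
            · exact hUn _ _ h hj
          rw [hz, tsum_zero]
        rw [this, mul_zero]
    have h1 := hmass.measure_univ
    rw [famP, heta] at h1
    have key := laplace_fin (Matrix.of fun i j : ↥U => W i.1 j.1) (fun i j => hsymm _ _)
      (etaOf W U) (fun i => r i.1) (fun i => hrpos _) h1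
    have hmap : Measure.map (fun (β : V → ℝ) (i : ↥U) => β i.1) ν
      = nuMeas (Matrix.of fun i j : ↥U => W i.1 j.1) (etaOf W U) := hR U hUne
    rw [← hmap, integral_map (Measurable.aemeasurable (by fun_prop))
      (Measurable.aestronglyMeasurable (by fun_prop))] at key
    simp only [hrsq, hreta, sub_self, add_zero, of_apply] at key
    have eL : ∀ β : V → ℝ, ∑' i, l i * β i = ∑ i : ↥U, l i.1 * β i.1 := by
      intro β
      rw [tsum_eq_sum (s := U) (fun i hi => by rw [hUs i hi, zero_mul])]
      exact (Finset.sum_coe_sort U (fun i => l i * β i)).symm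
    simp only [eL]
    rw [key]
    have eP : ∏' i : V, (1 + l i) ^ (-(1 / 2) : ℝ) = (∏ i : ↥U, r i.1)⁻¹ := by
      rw [tprod_eq_prod (s := U) (fun i hi => by rw [hUs i hi]; simp),
        Finset.prod_coe_sort U (fun i => r i), ← Finset.prod_inv_distrib]
      refine Finset.prod_congr rfl fun i _ => ?_
      rw [Real.rpow_neg (by linarith [hl i]), ← Real.sqrt_eq_rpow]
    have eS : (∑' p : V × V, if p.1 = p.2 then 0
          else W p.1 p.2 * (Real.sqrt ((1 + l p.1) * (1 + l p.2)) - 1))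
        = ∑ i : ↥U, ∑ j : ↥U, (r i.1 * W i.1 j.1 * r j.1 - W i.1 j.1) := by
      have e0 : ∀ p : V × V, (if p.1 = p.2 then 0
          else W p.1 p.2 * (Real.sqrt ((1 + l p.1) * (1 + l p.2)) - 1))
          = r p.1 * W p.1 p.2 * r p.2 - W p.1 p.2 := by
        rintro ⟨i, j⟩
        simp only []
        split_ifs with h
        · subst h; rw [hdiag]; ring
        · rw [Real.sqrt_mul (by linarith [hl i])]
          simp only [hrdef]; ring
      simp only [e0]
      rw [tsum_eq_sum (s := U ×ˢ U), Finset.sum_product]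
      · rw [← Finset.sum_coe_sort U]
        refine Finset.sum_congr rfl fun i _ => ?_
        rw [← Finset.sum_coe_sort U]
      · rintro ⟨i, j⟩ hp
        simp only [Finset.mem_product, not_and_or] at hp
        have : (l i = 0 ∧ l j = 0) ∨ W i j = 0 := by
          rcases hp with hp | hp
          · by_cases hj : l j = 0
            · exact Or.inl ⟨hUs i hp, hj⟩
            · right; rw [hsymm]; exact hUn j i hj hp
          · by_cases hi : l i = 0
            · exact Or.inl ⟨hi, hUs j hp⟩
            · right; exact hUn i j hi hp
        rcases this with ⟨h, h'⟩ | h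
        · simp only []
          rw [hr1 i h, hr1 j h']; ring
        · simp only []
          rw [h]; ring
    rw [eP, eS, mul_comm]
    simp only [Finset.sum_sub_distrib]
    congr 2
    ring

end
end

section
/- Let β ∈ D_V^W and i,j,z ∈ V. Then the sum of w(σ), in [0,∞], over all walks σ from i to j that visit z (i.e. σ_k = z for some 0 ≤ k ≤ ℓ) equals F(i,z)·G(z,j), where G = H_β^{-1} and F(i,z) = G(i,z)/G(z,z). -/
open MeasureTheory Matrix

noncomputable section

/-- `σ` is a walk from `i` to `j` (with respect to the weights `W`): a nonempty finite
sequence of vertices starting at `i`, ending at `j`, with consecutive vertices joined by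
an edge of positive weight. -/
def IsWalkBtw {V : Type*} (W : V → V → ℝ) (i j : V) (σ : List V) : Prop :=
  σ.head? = some i ∧ σ.getLast? = some j ∧ σ.Chain' (fun a b => 0 < W a b)

/-- The weight `w(σ) = (∏ W_{σ_k σ_{k+1}}) / (∏ 2 β_{σ_k})` of a walk. -/
def walkWeight {V : Type*} (W : V → V → ℝ) (β : V → ℝ) (σ : List V) : ℝ :=
  ((σ.zip σ.tail).map fun p => W p.1 p.2).prod / (σ.map fun v => 2 * β v).prod

namespace Stmt11Aux

variable {V : Type*} [Fintype V] [DecidableEq V]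

/-- Lists are either empty or a head and a tail. -/
def listEquiv (V : Type*) : (Unit ⊕ (V × List V)) ≃ List V where
  toFun x := match x with
    | Sum.inl _ => []
    | Sum.inr (a, l) => a :: l
  invFun l := match l with
    | [] => Sum.inl ()
    | a :: l => Sum.inr (a, l)
  left_inv x := by rcases x with _ | ⟨a, l⟩ <;> rfl
  right_inv l := by cases l <;> rfl

lemma tsum_list (f : List V → ENNReal) :
    ∑' l, f l = f [] + ∑ a, ∑' l, f (a :: l) := by
  rw [← (listEquiv V).tsum_eq f,
    Summable.tsum_sum ENNReal.summable ENNReal.summable, ENNReal.tsum_prod', tsum_fintype,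
    tsum_fintype]
  simp [listEquiv]

/-- Weight of the walk `a :: l` if it ends at `j`. -/
def om (W : Matrix V V ℝ) (β : V → ℝ) (j : V) : V → List V → ENNReal
  | a, [] => if a = j then ENNReal.ofReal (1 / (2 * β a)) else 0
  | a, b :: l => ENNReal.ofReal (W a b / (2 * β a)) * om W β j b l

open Classical in
lemma om_eq (W : Matrix V V ℝ) (hnn : ∀ i j, 0 ≤ W i j) (β : V → ℝ) (hb : ∀ i, 0 < β i)
    (j a : V) (l : List V) :
    (if IsWalkBtw (fun a b => W a b) a j (a :: l) then
      ENNReal.ofReal (walkWeight (fun a b => W a b) β (a :: l)) else 0) = om W β j a l := by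
  induction l generalizing a with
  | nil => simp [IsWalkBtw, walkWeight, om, List.Chain']
  | cons b l ih =>
    have hw : walkWeight (fun a b => W a b) β (a :: b :: l)
        = W a b / (2 * β a) * walkWeight (fun a b => W a b) β (b :: l) := by
      simp only [walkWeight, List.tail_cons, List.zip_cons_cons, List.map_cons, List.prod_cons]
      rw [mul_div_mul_comm]
    have hi : IsWalkBtw (fun a b => W a b) a j (a :: b :: l) ↔
        0 < W a b ∧ IsWalkBtw (fun a b => W a b) b j (b :: l) := by
      simp only [IsWalkBtw, List.Chain', List.isChain_cons_cons, List.head?_cons,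
        List.getLast?_cons_cons]
      tauto
    rw [om, ← ih, hw, ENNReal.ofReal_mul (div_nonneg (hnn _ _) (by linarith [hb a]))]
    by_cases h0 : 0 < W a b
    · by_cases h1 : IsWalkBtw (fun a b => W a b) b j (b :: l)
      · rw [if_pos (hi.2 ⟨h0, h1⟩), if_pos h1]
      · rw [if_neg (fun h => h1 (hi.1 h).2), if_neg h1, mul_zero]
    · have : W a b = 0 := le_antisymm (not_lt.1 h0) (hnn _ _)
      simp [this]

lemma Hmul (W : Matrix V V ℝ) (β x : V → ℝ) (i : V) :
    (Hmat W β *ᵥ x) i = 2 * β i * x i - ∑ k, W i k * x k := by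
  rw [Hmat, Matrix.sub_mulVec, Matrix.smul_mulVec, Pi.sub_apply, Pi.smul_apply,
    Matrix.mulVec_diagonal]
  simp only [nsmul_eq_mul, Nat.cast_ofNat, Matrix.mulVec, dotProduct]
  ring

lemma beta_pos {W : Matrix V V ℝ} (hdiag : ∀ i, W i i = 0) {β : V → ℝ}
    (hβ : (Hmat W β).PosDef) (i : V) : 0 < β i := by
  have := hβ.diag_pos (i := i)
  rw [Hmat, Matrix.sub_apply, Matrix.smul_apply, Matrix.diagonal_apply_eq, hdiag, nsmul_eq_mul,
    Nat.cast_ofNat] at this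
  linarith

lemma eq_zero_of_form {H : Matrix V V ℝ} (hH : H.PosDef) (x : V → ℝ)
    (h : ∑ i, x i * (H *ᵥ x) i ≤ 0) : x = 0 := by
  by_contra hx
  have := hH.dotProduct_mulVec_pos hx
  simp only [star_trivial, dotProduct] at this
  linarith

lemma H_col {H : Matrix V V ℝ} (hH : H.PosDef) (j i : V) :
    (H *ᵥ (fun k => H⁻¹ k j)) i = if i = j then 1 else 0 := by
  have h : H * H⁻¹ = 1 := Matrix.mul_nonsing_inv _ ((Matrix.isUnit_iff_isUnit_det _).1 hH.isUnit)
  have := congrFun (congrFun h i) j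
  rw [Matrix.one_apply] at this
  rw [← this, Matrix.mul_apply]; rfl

lemma G_nonneg {W : Matrix V V ℝ} (hnn : ∀ i j, 0 ≤ W i j) {β : V → ℝ}
    (hβ : (Hmat W β).PosDef) (i j : V) : 0 ≤ (Hmat W β)⁻¹ i j := by
  set x : V → ℝ := fun k => (Hmat W β)⁻¹ k j with hx
  set m : V → ℝ := fun k => max (-x k) 0 with hm
  have hm0 : m = 0 := by
    apply eq_zero_of_form hβ
    apply Finset.sum_nonpos
    intro a _
    have h1 := H_col hβ j a
    rw [← hx, Hmul] at h1
    have h3 : 0 ≤ 2 * β a * x a - ∑ k, W a k * x k := by rw [h1]; split_ifs <;> norm_num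
    rw [Hmul]
    have h4 : 0 ≤ ∑ k, W a k * (x k + m k) := by
      apply Finset.sum_nonneg
      intro k _
      apply mul_nonneg (hnn _ _)
      have := le_max_left (-x k) 0
      simp only [hm]; linarith
    simp only [mul_add, Finset.sum_add_distrib] at h4
    rcases le_total 0 (x a) with h | h
    · have : m a = 0 := by simp [hm, h]
      simp [this]
    · have : m a = - x a := by simp [hm, h]
      apply mul_nonpos_of_nonneg_of_nonpos
      · simp [hm]
      · rw [this]; linarith
  have := congrFun hm0 i
  simp only [hm, Pi.zero_apply, max_eq_right_iff] at this
  simp only [hx] at this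
  linarith

lemma S_le {W : Matrix V V ℝ} (hnn : ∀ i j, 0 ≤ W i j) {β : V → ℝ} (hb : ∀ i, 0 < β i)
    (hβ : (Hmat W β).PosDef) (j : V) (n : ℕ) (a : V) :
    ∑' l : List V, (if l.length < n then om W β j a l else 0)
      ≤ ENNReal.ofReal ((Hmat W β)⁻¹ a j) := by
  induction n generalizing a with
  | zero => simp
  | succ n ih =>
    rw [tsum_list]
    have hP : ∀ k, 0 ≤ W a k / (2 * β a) := fun k => div_nonneg (hnn _ _) (by linarith [hb a])
    have h1 := H_col hβ j a
    rw [Hmul] at h1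
    have h2 : (Hmat W β)⁻¹ a j = (if a = j then 1 / (2 * β a) else 0) +
        ∑ k, W a k / (2 * β a) * (Hmat W β)⁻¹ k j := by
      have hb' := (hb a).ne'
      have : ∑ k, W a k / (2 * β a) * (Hmat W β)⁻¹ k j
          = (∑ k, W a k * (Hmat W β)⁻¹ k j) / (2 * β a) := by
        rw [Finset.sum_div]; exact Finset.sum_congr rfl fun k _ => by ring
      rw [this]
      split_ifs at h1 ⊢ <;> field_simp <;> linarith
    rw [h2, ENNReal.ofReal_add (by have := hb a; split_ifs <;> positivity)
      (Finset.sum_nonneg fun k _ => mul_nonneg (hP k) (G_nonneg hnn hβ _ _)),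
      ENNReal.ofReal_sum_of_nonneg
      (fun k _ => mul_nonneg (hP k) (G_nonneg hnn hβ _ _))]
    apply add_le_add
    · simp only [List.length_nil, om]
      split_ifs <;> simp
    · apply Finset.sum_le_sum
      intro k _
      rw [ENNReal.ofReal_mul (hP k)]
      refine le_trans (le_of_eq ?_) (mul_le_mul_right (ih k) _)
      rw [← ENNReal.tsum_mul_left]
      apply tsum_congr
      intro l
      simp [om]

lemma g_le {W : Matrix V V ℝ} (hnn : ∀ i j, 0 ≤ W i j) {β : V → ℝ} (hb : ∀ i, 0 < β i)
    (hβ : (Hmat W β).PosDef) (j : V) (a : V) :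
    ∑' l : List V, om W β j a l ≤ ENNReal.ofReal ((Hmat W β)⁻¹ a j) := by
  rw [ENNReal.tsum_eq_iSup_sum]
  apply iSup_le
  intro s
  refine le_trans ?_ (S_le hnn hb hβ j (s.sup List.length + 1) a)
  refine le_trans (le_of_eq ?_) (ENNReal.sum_le_tsum s)
  apply Finset.sum_congr rfl
  intro l hl
  rw [if_pos (Nat.lt_succ_of_le (Finset.le_sup (f := List.length) hl))]

lemma toReal_rec {W : Matrix V V ℝ} (hnn : ∀ i j, 0 ≤ W i j) {β : V → ℝ} (hb : ∀ i, 0 < β i)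
    (u : V → ENNReal) (hu : ∀ a, u a ≠ ⊤) (a : V) (c : ℝ) (hc : 0 ≤ c)
    (h : u a = ENNReal.ofReal (c / (2 * β a)) + ∑ k, ENNReal.ofReal (W a k / (2 * β a)) * u k) :
    (Hmat W β *ᵥ (fun k => (u k).toReal)) a = c := by
  have hba := hb a
  rw [Hmul, h, ENNReal.toReal_add ENNReal.ofReal_ne_top
    (ENNReal.sum_ne_top.2 fun k _ => ENNReal.mul_ne_top ENNReal.ofReal_ne_top (hu k)),
    ENNReal.toReal_sum fun k _ => ENNReal.mul_ne_top ENNReal.ofReal_ne_top (hu k),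
    ENNReal.toReal_ofReal (by positivity)]
  have : ∀ k, (ENNReal.ofReal (W a k / (2 * β a)) * u k).toReal
      = W a k * (u k).toReal / (2 * β a) := by
    intro k
    rw [ENNReal.toReal_mul, ENNReal.toReal_ofReal (div_nonneg (hnn _ _) (by linarith))]
    ring
  simp only [this]
  rw [← Finset.sum_div]
  field_simp
  ring

lemma g_eq {W : Matrix V V ℝ} (hnn : ∀ i j, 0 ≤ W i j) {β : V → ℝ} (hb : ∀ i, 0 < β i)
    (hβ : (Hmat W β).PosDef) (j : V) (a : V) :
    (∑' l : List V, om W β j a l).toReal = (Hmat W β)⁻¹ a j := by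
  set u : V → ENNReal := fun a => ∑' l : List V, om W β j a l with hu
  have hut : ∀ a, u a ≠ ⊤ := fun a => ne_top_of_le_ne_top ENNReal.ofReal_ne_top (g_le hnn hb hβ j a)
  have h1 : ∀ a, (Hmat W β *ᵥ (fun k => (u k).toReal)) a = if a = j then 1 else 0 := by
    intro a
    apply toReal_rec hnn hb u hut a
    · split_ifs <;> norm_num
    · simp only [hu]
      rw [tsum_list]
      simp only [om, ENNReal.tsum_mul_left]
      congr 1
      split_ifs <;> simp
  have h2 : (fun k => (u k).toReal) - (fun k => (Hmat W β)⁻¹ k j) = 0 := by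
    apply eq_zero_of_form hβ
    apply le_of_eq
    apply Finset.sum_eq_zero
    intro k _
    rw [Matrix.mulVec_sub, Pi.sub_apply (_ *ᵥ _), h1, H_col hβ, sub_self, mul_zero]
  have := congrFun h2 a
  simp only [Pi.sub_apply, Pi.zero_apply] at this
  linarith

lemma u_eq {W : Matrix V V ℝ} (hnn : ∀ i j, 0 ≤ W i j) {β : V → ℝ} (hb : ∀ i, 0 < β i)
    (hβ : (Hmat W β).PosDef) (j z : V) (a : V) :
    ∑' l : List V, (if z ∈ a :: l then om W β j a l else 0) =
      ENNReal.ofReal (((Hmat W β)⁻¹ a z / (Hmat W β)⁻¹ z z) * (Hmat W β)⁻¹ z j) := by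
  set u : V → ENNReal := fun a => ∑' l : List V, (if z ∈ a :: l then om W β j a l else 0) with hu
  have hut : ∀ a, u a ≠ ⊤ := by
    intro a
    refine ne_top_of_le_ne_top ENNReal.ofReal_ne_top (le_trans ?_ (g_le hnn hb hβ j a))
    apply ENNReal.tsum_le_tsum
    intro l
    split_ifs <;> simp
  have hz : (u z).toReal = (Hmat W β)⁻¹ z j := by
    rw [← g_eq hnn hb hβ]
    simp [hu]
  have h1 : ∀ a, a ≠ z → (Hmat W β *ᵥ (fun k => (u k).toReal)) a = 0 := by
    intro a ha
    apply toReal_rec hnn hb u hut a 0 le_rfl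
    simp only [hu]
    rw [tsum_list]
    simp only [← ENNReal.tsum_mul_left]
    congr 1
    · simp [ha.symm]
    · apply Finset.sum_congr rfl
      intro k _
      apply tsum_congr
      intro l
      rw [om, mul_ite, mul_zero]
      congr 1
      simp [ha.symm]
  have hzz : 0 < (Hmat W β)⁻¹ z z := hβ.inv.diag_pos
  set c : ℝ := (Hmat W β)⁻¹ z j / (Hmat W β)⁻¹ z z with hc
  have h2 : (fun k => (u k).toReal) - c • (fun k => (Hmat W β)⁻¹ k z) = 0 := by
    apply eq_zero_of_form hβ
    apply le_of_eq
    apply Finset.sum_eq_zero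
    intro k _
    by_cases hk : k = z
    · subst hk
      have : ((fun k => (u k).toReal) - c • (fun l => (Hmat W β)⁻¹ l k)) k = 0 := by
        simp only [Pi.sub_apply, Pi.smul_apply, smul_eq_mul, hz, hc]
        field_simp
        ring
      rw [this, zero_mul]
    · rw [Matrix.mulVec_sub, Matrix.mulVec_smul, Pi.sub_apply (_ *ᵥ _), Pi.smul_apply, h1 k hk,
        H_col hβ, if_neg hk, smul_zero, sub_self, mul_zero]
  have h3 := congrFun h2 a
  simp only [Pi.sub_apply, Pi.smul_apply, smul_eq_mul, Pi.zero_apply] at h3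
  refine (ENNReal.ofReal_toReal (hut a)).symm.trans ?_
  congr 1
  rw [sub_eq_zero.1 h3, hc]
  ring

end Stmt11Aux

theorem stmt11 {V : Type*} [Fintype V] [DecidableEq V] [Nonempty V]
    (W : Matrix V V ℝ) (hsymm : W.IsSymm) (hnn : ∀ i j, 0 ≤ W i j)
    (hdiag : ∀ i, W i i = 0) (hconn : (graphOf W).Connected)
    (β : V → ℝ) (hβ : (Hmat W β).PosDef) (i j z : V) :
    ∑' σ : {l : List V // IsWalkBtw (fun a b => W a b) i j l ∧ z ∈ l},
        ENNReal.ofReal (walkWeight (fun a b => W a b) β σ.1)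
      = ENNReal.ofReal
          (((Hmat W β)⁻¹ i z / (Hmat W β)⁻¹ z z) * (Hmat W β)⁻¹ z j) := by
  classical
  have hb := Stmt11Aux.beta_pos hdiag hβ
  rw [← Stmt11Aux.u_eq hnn hb hβ j z i]
  have h := tsum_subtype {l : List V | IsWalkBtw (fun a b => W a b) i j l ∧ z ∈ l}
    (fun l => ENNReal.ofReal (walkWeight (fun a b => W a b) β l))
  refine h.trans ?_
  rw [Stmt11Aux.tsum_list, Finset.sum_eq_single i]
  · rw [Set.indicator_of_notMem (by simp), zero_add]
    apply tsum_congr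
    intro l
    rw [← Stmt11Aux.om_eq W hnn β hb]
    by_cases h1 : IsWalkBtw (fun a b => W a b) i j (i :: l)
    · by_cases h2 : z ∈ i :: l
      · rw [if_pos h2, if_pos h1]
        apply Set.indicator_of_mem
        exact And.intro h1 h2
      · rw [if_neg h2]
        exact Set.indicator_of_notMem (fun h => h2 h.2) _
    · rw [if_neg h1, ite_self]
      exact Set.indicator_of_notMem (fun h => h1 h.1) _
  · intro a _ ha
    rw [ENNReal.tsum_eq_zero]
    intro l
    apply Set.indicator_of_notMem
    rintro ⟨⟨h1, _⟩, _⟩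
    simp at h1
    exact ha h1
  · simp

end
end
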